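/- Let H be a Hamiltonian on [a,b), and set α_{n,m}(t) = ∫_a^t W_n(s)H(s)W_m(s)* ds and β_{n,m}(t) = W_n(t) J W_m(t)*. Then for all t ∈ [a,b): α_{n,m+1}(t) − α_{n+1,m}(t) = β_{n+1,m+1}(t) for all n, m ≥ 0, and α_{n,0}(t) = β_{n+1,0}(t) and α_{0,n}(t) = −β_{0,n+1}(t) for all n ≥ 0. -/

import Mathlib

open MeasureTheory Filter Topology Matrix Set
open scoped ENNReal

noncomputable section

/-- The symplectic matrix `J = [[0,-1],[1,0]]` (real version). -/
def Jmat : Matrix (Fin 2) (Fin 2) ℝ := !![0, -1; 1, 0]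

/-- The symplectic matrix `J` (complex version). -/
def JmatC : Matrix (Fin 2) (Fin 2) ℂ := !![0, -1; 1, 0]

/-- `|J| = [[0,1],[1,0]]`. -/
def Jabs : Matrix (Fin 2) (Fin 2) ℝ := !![0, 1; 1, 0]

/-- The entrywise comparison `|U| ⪯ V`. -/
def entryAbsLe (U V : Matrix (Fin 2) (Fin 2) ℝ) : Prop :=
  ∀ i j, |U i j| ≤ V i j

/-- The filter describing `t → b⁻`, `t` ranging over the reals, `b : EReal`. -/
def toBFilter (b : EReal) : Filter ℝ :=
  Filter.comap (fun t : ℝ => (t : EReal)) (nhdsWithin b (Set.Iio b))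

/-- `H` is a Hamiltonian on `[a, b)`. -/
structure IsHamiltonian (a : ℝ) (b : EReal) (H : ℝ → Matrix (Fin 2) (Fin 2) ℝ) : Prop where
  a_lt_b : (a : EReal) < b
  posSemidef : ∀ᵐ (t : ℝ) ∂volume, a ≤ t → (t : EReal) < b → (H t).PosSemidef
  locInt : ∀ (i j : Fin 2) (t : ℝ), a ≤ t → (t : EReal) < b →
    IntervalIntegrable (fun s => H s i j) volume a t
  zero_null : volume {t : ℝ | a ≤ t ∧ (t : EReal) < b ∧ H t = 0} = 0
  limit_point : (∫⁻ t in {t : ℝ | a ≤ t ∧ (t : EReal) < b},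
    ENNReal.ofReal ((H t).trace)) = ⊤

/-- `m1(t) = ∫_a^t h1`. -/
def m1 (a : ℝ) (H : ℝ → Matrix (Fin 2) (Fin 2) ℝ) (t : ℝ) : ℝ := ∫ s in a..t, H s 0 0

/-- `m2(t) = ∫_a^t h2`. -/
def m2 (a : ℝ) (H : ℝ → Matrix (Fin 2) (Fin 2) ℝ) (t : ℝ) : ℝ := ∫ s in a..t, H s 1 1

/-- `m3(t) = ∫_a^t h3`. -/
def m3 (a : ℝ) (H : ℝ → Matrix (Fin 2) (Fin 2) ℝ) (t : ℝ) : ℝ := ∫ s in a..t, H s 0 1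

/-- `M(t) = ∫_a^t H(s) ds`. -/
def Mmat (a : ℝ) (H : ℝ → Matrix (Fin 2) (Fin 2) ℝ) (t : ℝ) : Matrix (Fin 2) (Fin 2) ℝ :=
  !![m1 a H t, m3 a H t; m3 a H t, m2 a H t]

/-- Neither diagonal entry of `H` vanishes a.e. on any neighbourhood of `a`. -/
def DiagNonVanishing (a : ℝ) (b : EReal) (H : ℝ → Matrix (Fin 2) (Fin 2) ℝ) : Prop :=
  (∀ t : ℝ, a < t → (t : EReal) < b →
    ¬ ∀ᵐ s ∂(volume.restrict (Set.Ioo a t)), H s 0 0 = 0) ∧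
  (∀ t : ℝ, a < t → (t : EReal) < b →
    ¬ ∀ᵐ s ∂(volume.restrict (Set.Ioo a t)), H s 1 1 = 0)

/-- `W` is the fundamental solution of `W(t,z)J − J = z ∫_a^t W(s,z)H(s) ds`. -/
def IsFundamentalSolution (a : ℝ) (b : EReal) (H : ℝ → Matrix (Fin 2) (Fin 2) ℝ)
    (W : ℝ → ℂ → Matrix (Fin 2) (Fin 2) ℂ) : Prop :=
  ∀ (z : ℂ) (t : ℝ), a ≤ t → (t : EReal) < b →
    W t z * JmatC - JmatC =
      z • Matrix.of fun i j =>
        ∫ s in a..t, (W s z * (H s).map (fun x : ℝ => (x : ℂ))) i j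

/-- `qH` is the Weyl coefficient of the Hamiltonian `H`. -/
def IsWeylCoefficient (a : ℝ) (b : EReal) (H : ℝ → Matrix (Fin 2) (Fin 2) ℝ)
    (qH : ℂ → ℂ) : Prop :=
  ∃ W : ℝ → ℂ → Matrix (Fin 2) (Fin 2) ℂ,
    IsFundamentalSolution a b H W ∧
    ∀ z : ℂ, z.im ≠ 0 → ∀ ζ : ℂ, 0 ≤ ζ.im →
      Tendsto (fun t : ℝ =>
          (W t z 0 0 * ζ + W t z 0 1) / (W t z 1 0 * ζ + W t z 1 1))
        (toBFilter b) (nhds (qH z))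

/-- `μ` is the spectral measure of `H`, i.e. the measure in the Herglotz
representation of the Weyl coefficient of `H`. -/
def IsSpectralMeasure (a : ℝ) (b : EReal) (H : ℝ → Matrix (Fin 2) (Fin 2) ℝ)
    (μ : Measure ℝ) : Prop :=
  ∃ qH : ℂ → ℂ, IsWeylCoefficient a b H qH ∧
    (∫⁻ t : ℝ, ENNReal.ofReal (1 / (1 + t ^ 2)) ∂μ) < ⊤ ∧
    ∃ α β : ℝ, 0 ≤ β ∧ ∀ z : ℂ, z.im ≠ 0 →
      qH z = (α : ℂ) + (β : ℂ) * z +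
        ∫ t : ℝ, (1 / ((t : ℂ) - z) - (t : ℂ) / (1 + (t : ℂ) ^ 2)) ∂μ

/-- `μ↔(r) = μ((−r, r))`. -/
def muSym (μ : Measure ℝ) (r : ℝ) : ℝ≥0∞ := μ (Set.Ioo (-r) r)

/-- Poisson integral of a measure. -/
def poisson (μ : Measure ℝ) (z : ℂ) : ℝ := ∫ t : ℝ, (1 / ((t : ℂ) - z)).im ∂μ

/-- `g : (0,∞) → (0,∞)` is regularly varying with index `ρ`. -/
def RegularlyVarying (g : ℝ → ℝ) (ρ : ℝ) : Prop :=
  Measurable g ∧ (∀ r : ℝ, 0 < r → 0 < g r) ∧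
  ∀ l : ℝ, 0 < l → Tendsto (fun r : ℝ => g (l * r) / g r) atTop (nhds (l ^ ρ))

/-- `g⋆(r) = ∫_1^r t/g(t) dt`. -/
def gstar (g : ℝ → ℝ) (r : ℝ) : ℝ := ∫ t in (1:ℝ)..r, t / g t

/-- The Kac class `𝓜_g`. -/
def memMg (g : ℝ → ℝ) (μ : Measure ℝ) : Prop :=
  (∫⁻ r in Set.Ici (1:ℝ), ENNReal.ofReal (1 / g r)
    ∂(Measure.map (fun t : ℝ => |t|) μ)) < ⊤

/-- The class `𝓜̂_g`. -/
def memMhat (g : ℝ → ℝ) (μ : Measure ℝ) : Prop :=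
  (∫⁻ r in Set.Ioi (1:ℝ), muSym μ r * ENNReal.ofReal (gstar g r / r ^ 3)) < ⊤

/-- The class `𝓕_g`: `μ↔(r) = O(g(r))`. -/
def memFg (g : ℝ → ℝ) (μ : Measure ℝ) : Prop :=
  ∃ C : ℝ, ∀ᶠ r in atTop, muSym μ r ≤ ENNReal.ofReal (C * g r)

/-- The class `𝓕_g⁰`: `μ↔(r) = o(g(r))`. -/
def memFg0 (g : ℝ → ℝ) (μ : Measure ℝ) : Prop :=
  ∀ ε : ℝ, 0 < ε → ∀ᶠ r in atTop, muSym μ r ≤ ENNReal.ofReal (ε * g r)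

/-- `M⁺(t)`. -/
def MplusMat (a : ℝ) (H : ℝ → Matrix (Fin 2) (Fin 2) ℝ) (t : ℝ) :
    Matrix (Fin 2) (Fin 2) ℝ :=
  !![m1 a H t, Real.sqrt (m1 a H t * m2 a H t);
     Real.sqrt (m1 a H t * m2 a H t), m2 a H t]

/-- `m⁺(t) = 2√(m1(t)m2(t))`. -/
def mplus (a : ℝ) (H : ℝ → Matrix (Fin 2) (Fin 2) ℝ) (t : ℝ) : ℝ :=
  2 * Real.sqrt (m1 a H t * m2 a H t)

/-- `W` is the sequence of power series coefficients of the fundamental solution: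
`W_0 = I`, `W_{n+1}(t) = (∫_a^t W_n H)·(−J)`. -/
def IsCoeffSeq (a : ℝ) (H : ℝ → Matrix (Fin 2) (Fin 2) ℝ)
    (W : ℕ → ℝ → Matrix (Fin 2) (Fin 2) ℝ) : Prop :=
  (∀ t : ℝ, W 0 t = 1) ∧
  ∀ (n : ℕ) (t : ℝ),
    W (n + 1) t = (Matrix.of fun i j => ∫ s in a..t, (W n s * H s) i j) * (-Jmat)

/-- Entrywise integral of a matrix-valued function. -/
def intMat (f : ℝ → Matrix (Fin 2) (Fin 2) ℝ) (a t : ℝ) : Matrix (Fin 2) (Fin 2) ℝ :=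
  Matrix.of fun i j => ∫ s in a..t, f s i j

/-- `α_{n,m}(t) = ∫_a^t W_n H W_m* ds`. -/
def alphaMat (a : ℝ) (H : ℝ → Matrix (Fin 2) (Fin 2) ℝ)
    (W : ℕ → ℝ → Matrix (Fin 2) (Fin 2) ℝ) (n m : ℕ) (t : ℝ) :
    Matrix (Fin 2) (Fin 2) ℝ :=
  intMat (fun s => W n s * H s * (W m s)ᵀ) a t

/-- `β_{n,m}(t) = W_n(t) J W_m(t)*`. -/
def betaMat (W : ℕ → ℝ → Matrix (Fin 2) (Fin 2) ℝ) (n m : ℕ) (t : ℝ) :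
    Matrix (Fin 2) (Fin 2) ℝ :=
  W n t * Jmat * (W m t)ᵀ

/-- `∇(t,z) = ∫_a^t W(s,z) H(s) W(s,z)* ds`. -/
def nablaMat (a : ℝ) (H : ℝ → Matrix (Fin 2) (Fin 2) ℝ)
    (W : ℝ → ℂ → Matrix (Fin 2) (Fin 2) ℂ) (t : ℝ) (z : ℂ) :
    Matrix (Fin 2) (Fin 2) ℂ :=
  Matrix.of fun i j =>
    ∫ s in a..t, (W s z * (H s).map (fun x : ℝ => (x : ℂ)) * (W s z)ᴴ) i j

/-- Generalised inverse of `f : [a,b) → ℝ`. -/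
def genInv (a : ℝ) (b : EReal) (f : ℝ → ℝ) (y : ℝ) : ℝ :=
  sInf {x : ℝ | a ≤ x ∧ (x : EReal) < b ∧ y ≤ f x}

/-- Generalised inverse of `f : [0,b) → [0,∞]`. -/
def genInvE (b : EReal) (f : ℝ → ℝ≥0∞) (y : ℝ) : ℝ :=
  sInf {x : ℝ | 0 ≤ x ∧ (x : EReal) < b ∧ ENNReal.ofReal y ≤ f x}

/-- Integration by parts for the primitives of two integrable functions. -/
lemma integral_mul_primitive_add_primitive_mul {f g : ℝ → ℝ} {a t : ℝ}
    (hf : IntervalIntegrable f volume a t) (hg : IntervalIntegrable g volume a t) :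
    ∫ s in a..t, (f s * (∫ u in a..s, g u) + (∫ u in a..s, f u) * g s) =
      (∫ u in a..t, f u) * (∫ u in a..t, g u) := by
  have hF := hf.absolutelyContinuousOnInterval_intervalIntegral (c := a) (by simp)
  have hG := hg.absolutelyContinuousOnInterval_intervalIntegral (c := a) (by simp)
  have key := hF.integral_deriv_mul_eq_sub hG
  simp only [intervalIntegral.integral_same, mul_zero, sub_zero] at key
  rw [← key]
  apply intervalIntegral.integral_congr_ae
  filter_upwards [hf.ae_hasDerivAt_integral, hg.ae_hasDerivAt_integral] with s hfs hgs hs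
  have hs' := uIoc_subset_uIcc hs
  rw [(hfs hs' a (by simp)).deriv, (hgs hs' a (by simp)).deriv]

lemma continuousOn_intMat {F : ℝ → Matrix (Fin 2) (Fin 2) ℝ} {a t : ℝ}
    (hF : ∀ i j, IntervalIntegrable (fun s => F s i j) volume a t) (i j : Fin 2) :
    ContinuousOn (fun s => intMat F a s i j) (uIcc a t) :=
  ((hF i j).absolutelyContinuousOnInterval_intervalIntegral (c := a) (by simp)).continuousOn

lemma intMat_congr_ae {F G : ℝ → Matrix (Fin 2) (Fin 2) ℝ} {a t : ℝ}
    (h : ∀ᵐ s ∂volume, s ∈ uIoc a t → F s = G s) : intMat F a t = intMat G a t := by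
  ext i j
  refine intervalIntegral.integral_congr_ae ?_
  filter_upwards [h] with s hs hst
  rw [hs hst]

lemma intMat_transpose (F : ℝ → Matrix (Fin 2) (Fin 2) ℝ) (a t : ℝ) :
    intMat (fun s => (F s)ᵀ) a t = (intMat F a t)ᵀ := rfl

lemma mul_Jmat_mul_transpose_apply (A B : Matrix (Fin 2) (Fin 2) ℝ) (i j : Fin 2) :
    (A * Jmat * Bᵀ) i j = A i 1 * B j 0 - A i 0 * B j 1 := by
  simp [Matrix.mul_apply, Fin.sum_univ_two, Jmat]
  ring

lemma Jmat_mul_Jmat : Jmat * Jmat = -1 := by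
  ext i j
  fin_cases i <;> fin_cases j <;> simp [Jmat, Matrix.mul_apply, Fin.sum_univ_two]

lemma Jmat_transpose : Jmatᵀ = -Jmat := by
  ext i j
  fin_cases i <;> fin_cases j <;> simp [Jmat]

/-- Matrix integration by parts for the bilinear map `(A, B) ↦ A J B*`. -/
lemma intMat_mul_Jmat_mul_transpose {F G : ℝ → Matrix (Fin 2) (Fin 2) ℝ} {a t : ℝ}
    (hF : ∀ i j, IntervalIntegrable (fun s => F s i j) volume a t)
    (hG : ∀ i j, IntervalIntegrable (fun s => G s i j) volume a t) :
    intMat (fun s => F s * Jmat * (intMat G a s)ᵀ) a t -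
        intMat (fun s => -(intMat F a s * Jmat * (G s)ᵀ)) a t =
      intMat F a t * Jmat * (intMat G a t)ᵀ := by
  have h₁ (i j k l : Fin 2) :
      IntervalIntegrable (fun s => F s i k * intMat G a s j l) volume a t :=
    (hF i k).mul_continuousOn (continuousOn_intMat hG j l)
  have h₂ (i j k l : Fin 2) :
      IntervalIntegrable (fun s => intMat F a s i k * G s j l) volume a t :=
    (hG j l).continuousOn_mul (continuousOn_intMat hF i k)
  have parts (i j k l : Fin 2) :
      (∫ s in a..t, F s i k * intMat G a s j l) + ∫ s in a..t, intMat F a s i k * G s j l =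
        intMat F a t i k * intMat G a t j l := by
    rw [← intervalIntegral.integral_add (h₁ i j k l) (h₂ i j k l)]
    exact integral_mul_primitive_add_primitive_mul (hF i k) (hG j l)
  ext i j
  rw [mul_Jmat_mul_transpose_apply, ← parts, ← parts, Matrix.sub_apply]
  change (∫ s in a..t, (F s * Jmat * (intMat G a s)ᵀ) i j) -
    (∫ s in a..t, -(intMat F a s * Jmat * (G s)ᵀ) i j) = _
  simp only [mul_Jmat_mul_transpose_apply]
  rw [intervalIntegral.integral_neg, intervalIntegral.integral_sub (h₁ i j 1 0) (h₁ i j 0 1),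
    intervalIntegral.integral_sub (h₂ i j 1 0) (h₂ i j 0 1)]
  ring

lemma IsHamiltonian.ae_transpose_eq {a : ℝ} {b : EReal} {H : ℝ → Matrix (Fin 2) (Fin 2) ℝ}
    (hH : IsHamiltonian a b H) {t : ℝ} (hat : a ≤ t) (htb : (t : EReal) < b) :
    ∀ᵐ s ∂volume, s ∈ uIoc a t → (H s)ᵀ = H s := by
  filter_upwards [hH.posSemidef] with s hs hst
  rw [uIoc_of_le hat] at hst
  have h := (hs hst.1.le ((EReal.coe_le_coe_iff.2 hst.2).trans_lt htb)).isHermitian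
  rwa [Matrix.IsHermitian, Matrix.conjTranspose_eq_transpose_of_trivial] at h

lemma intervalIntegrable_mul_of_continuousOn {A H : ℝ → Matrix (Fin 2) (Fin 2) ℝ} {a t : ℝ}
    (hA : ∀ i j, ContinuousOn (fun s => A s i j) (uIcc a t))
    (hH : ∀ i j, IntervalIntegrable (fun s => H s i j) volume a t) (i j : Fin 2) :
    IntervalIntegrable (fun s => (A s * H s) i j) volume a t := by
  simp only [Matrix.mul_apply, Fin.sum_univ_two]
  exact ((hH 0 j).continuousOn_mul (hA i 0)).add ((hH 1 j).continuousOn_mul (hA i 1))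

namespace IsCoeffSeq

variable {a : ℝ} {H : ℝ → Matrix (Fin 2) (Fin 2) ℝ} {W : ℕ → ℝ → Matrix (Fin 2) (Fin 2) ℝ}

lemma succ_eq (hW : IsCoeffSeq a H W) (n : ℕ) (t : ℝ) :
    W (n + 1) t = -(intMat (fun s => W n s * H s) a t * Jmat) := by
  rw [hW.2, Matrix.mul_neg]
  rfl

lemma succ_mul_Jmat (hW : IsCoeffSeq a H W) (n : ℕ) (t : ℝ) :
    W (n + 1) t * Jmat = intMat (fun s => W n s * H s) a t := by
  rw [hW.succ_eq, Matrix.neg_mul, Matrix.mul_assoc, Jmat_mul_Jmat, Matrix.mul_neg,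
    Matrix.mul_one, neg_neg]

lemma succ_transpose (hW : IsCoeffSeq a H W) (n : ℕ) (t : ℝ) :
    (W (n + 1) t)ᵀ = Jmat * (intMat (fun s => W n s * H s) a t)ᵀ := by
  rw [hW.succ_eq, Matrix.transpose_neg, Matrix.transpose_mul, Jmat_transpose, Matrix.neg_mul,
    neg_neg]

lemma continuousOn (hW : IsCoeffSeq a H W) {t : ℝ}
    (hH : ∀ i j, IntervalIntegrable (fun s => H s i j) volume a t) (n : ℕ) :
    ∀ i j, ContinuousOn (fun s => W n s i j) (uIcc a t) := by
  induction n with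
  | zero => simp only [hW.1, continuousOn_const, implies_true]
  | succ n ih =>
    intro i j
    have h := continuousOn_intMat (intervalIntegrable_mul_of_continuousOn ih hH)
    simp only [hW.succ_eq, Matrix.neg_apply, Matrix.mul_apply, Fin.sum_univ_two]
    exact (((h i 0).mul continuousOn_const).add ((h i 1).mul continuousOn_const)).neg

end IsCoeffSeq

/-- Lemma 3.5: formulae relating `α_{n,m}` to `β_{k,l}`. -/
theorem stmt8 (a : ℝ) (b : EReal) (H : ℝ → Matrix (Fin 2) (Fin 2) ℝ)
    (hH : IsHamiltonian a b H)
    (W : ℕ → ℝ → Matrix (Fin 2) (Fin 2) ℝ) (hW : IsCoeffSeq a H W) :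
    ∀ t : ℝ, a ≤ t → (t : EReal) < b →
      (∀ n m : ℕ,
        alphaMat a H W n (m + 1) t - alphaMat a H W (n + 1) m t =
          betaMat W (n + 1) (m + 1) t) ∧
      (∀ n : ℕ, alphaMat a H W n 0 t = betaMat W (n + 1) 0 t ∧
        alphaMat a H W 0 n t = - betaMat W 0 (n + 1) t) := by
  intro t hat htb
  have hloc : ∀ i j, IntervalIntegrable (fun s => H s i j) volume a t :=
    fun i j => hH.locInt i j t hat htb
  have hint (n : ℕ) := intervalIntegrable_mul_of_continuousOn (hW.continuousOn hloc n) hloc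
  have hsymm := hH.ae_transpose_eq hat htb
  refine ⟨fun n m => ?_, fun n => ⟨?_, ?_⟩⟩
  · have h₁ : alphaMat a H W n (m + 1) t = intMat (fun s => W n s * H s * Jmat *
        (intMat (fun u => W m u * H u) a s)ᵀ) a t := by
      simp only [alphaMat, hW.succ_transpose, Matrix.mul_assoc]
    have h₂ : alphaMat a H W (n + 1) m t = intMat (fun s =>
        -(intMat (fun u => W n u * H u) a s * Jmat * (W m s * H s)ᵀ)) a t := by
      refine intMat_congr_ae ?_
      filter_upwards [hsymm] with s hs hst
      rw [Matrix.transpose_mul, hs hst, hW.succ_eq]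
      simp only [Matrix.neg_mul, Matrix.mul_assoc]
    rw [h₁, h₂, intMat_mul_Jmat_mul_transpose (hint n) (hint m), betaMat, hW.succ_mul_Jmat,
      hW.succ_transpose, ← Matrix.mul_assoc]
  · simp only [alphaMat, betaMat, hW.succ_mul_Jmat, hW.1, Matrix.transpose_one, Matrix.mul_one]
  · have h : alphaMat a H W 0 n t = intMat (fun s => (W n s * H s)ᵀ) a t := by
      refine intMat_congr_ae ?_
      filter_upwards [hsymm] with s hs hst
      rw [Matrix.transpose_mul, hs hst, hW.1, Matrix.one_mul]
    rw [h, intMat_transpose, betaMat, hW.1, Matrix.one_mul, hW.succ_transpose,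
      ← Matrix.mul_assoc, Jmat_mul_Jmat, Matrix.neg_mul, Matrix.one_mul, neg_neg]
end
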